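/- arXiv:1310.0141 — 3 statements merged into one kernel-verified Lean document; each statement's English description precedes it below -/
import Mathlib

section
/- Let n ≥ 1, let m < 2^n be a mask and p a pattern for m, and let x < 2^n satisfy x &&& m ≠ p. Let j be the most significant bit position at which x &&& m and p differ, and suppose bit j of p is 0 (so bit j of x is 1; a positive mismatch). Let G = {g : j < g < n ∧ bit g of x is 0 ∧ bit g of m is 0}. If G is empty, then no y with x < y < 2^n satisfies y &&& m = p. If G is nonempty and g = min G, then the minimum of {y : x < y < 2^n ∧ y &&& m = p} equals 2^{g+1}·⌊x/2^{g+1}⌋ + 2^g + (p mod 2^g). (Correctness of the point matcher's Hint operation for positive mismatches, with g the 'growth point'.) -/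
/-- If `x < y` then at the most significant differing bit `x` has `0` and `y` has `1`. -/
theorem Nat.exists_testBit_of_lt {x y : ℕ} (h : x < y) :
    ∃ k, x.testBit k = false ∧ y.testBit k = true ∧
      ∀ i, k < i → x.testBit i = y.testBit i := by
  obtain ⟨k, hk, hi⟩ := Nat.exists_most_significant_bit (Nat.xor_ne_zero_iff.mpr h.ne)
  simp only [Nat.testBit_xor, bne_eq_false_iff_eq, bne_iff_ne] at hk hi
  cases hxk : x.testBit k
  · exact ⟨k, hxk, by simpa [hxk] using hk, hi⟩
  · have hyk : y.testBit k = false := by simpa [hxk] using hk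
    exact absurd (Nat.lt_of_testBit k hyk hxk fun i hki => (hi i hki).symm) h.not_gt

/-- The bits of the number with the bits of `x` above `g`, a `1` at `g`, and the bits of `p`
below `g`. -/
theorem Nat.testBit_splice (x p g i : ℕ) :
    (2 ^ (g + 1) * (x / 2 ^ (g + 1)) + 2 ^ g + p % 2 ^ g).testBit i =
      if i < g then p.testBit i else if i = g then true else x.testBit i := by
  have hp : p % 2 ^ g < 2 ^ g := Nat.mod_lt _ (by positivity)
  have hlow : 2 ^ g + p % 2 ^ g < 2 ^ (g + 1) := by rw [pow_succ]; omega
  rw [add_assoc, Nat.testBit_two_pow_mul_add _ hlow]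
  rcases lt_trichotomy i g with h | rfl | h
  · rw [if_pos (by omega), if_pos h, Nat.testBit_two_pow_add_gt h]
    simp [Nat.testBit_mod_two_pow, h]
  · rw [if_pos (by omega), Nat.testBit_two_pow_add_eq]
    simp [Nat.testBit_mod_two_pow]
  · rw [if_neg (by omega), if_neg (by omega), if_neg (by omega), Nat.testBit_div_two_pow]
    congr 1
    omega

/-- Correctness of the point matcher's `Hint` operation for a positive mismatch:
with `j` the most significant mismatching bit (where `p`'s bit is `0`), and
`G` the set of candidate growth points (positions `g` with `j < g < n` at which both `x`
and `m` have bit `0`): if `G` is empty there is no matching key in `(x, 2^n)`, and if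
`g = min G` then the least matching key in `(x, 2^n)` is
`2^{g+1}·⌊x/2^{g+1}⌋ + 2^g + (p mod 2^g)`. -/
theorem point_hint_positive_mismatch (n m p x j : ℕ) (hn : 1 ≤ n) (hm : m < 2 ^ n)
    (hp : p &&& m = p) (hx : x < 2 ^ n) (hne : x &&& m ≠ p)
    (hj : (x &&& m).testBit j ≠ p.testBit j ∧
      ∀ i, j < i → (x &&& m).testBit i = p.testBit i)
    (hpj : p.testBit j = false) :
    ({g : ℕ | j < g ∧ g < n ∧ x.testBit g = false ∧ m.testBit g = false} = ∅ →
      ∀ y, x < y → y < 2 ^ n → y &&& m ≠ p) ∧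
    (∀ g, IsLeast {g : ℕ | j < g ∧ g < n ∧ x.testBit g = false ∧ m.testBit g = false} g →
      IsLeast {y : ℕ | x < y ∧ y < 2 ^ n ∧ y &&& m = p}
        (2 ^ (g + 1) * (x / 2 ^ (g + 1)) + 2 ^ g + p % 2 ^ g)) := by
  have hpm (i : ℕ) : (p.testBit i && m.testBit i) = p.testBit i := by
    rw [← Nat.testBit_and, hp]
  obtain ⟨hjne, hagree⟩ := hj
  simp only [Nat.testBit_and] at hjne hagree
  have hxj : x.testBit j = true ∧ m.testBit j = true := by simpa [hpj] using hjne
  have growth (y : ℕ) (hxy : x < y) (hyn : y < 2 ^ n) (hy : y &&& m = p) :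
      ∃ k, (j < k ∧ k < n ∧ x.testBit k = false ∧ m.testBit k = false) ∧
        y.testBit k = true ∧ ∀ i, k < i → x.testBit i = y.testBit i := by
    obtain ⟨k, hxk, hyk, hk⟩ := Nat.exists_testBit_of_lt hxy
    have hym (i : ℕ) : (y.testBit i && m.testBit i) = p.testBit i := by
      rw [← Nat.testBit_and, hy]
    have hkn : k < n := by
      by_contra! h
      have := Nat.testBit_lt_two_pow (hyn.trans_le (Nat.pow_le_pow_right two_pos h))
      simp_all
    have hjk : j < k := by
      rcases lt_trichotomy j k with h | rfl | h
      · exact h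
      · simp_all
      · have := hym j
        simp [← hk j h, hxj, hpj] at this
    refine ⟨k, ⟨hjk, hkn, hxk, ?_⟩, hyk, hk⟩
    have h₁ := hym k
    have h₂ := hagree k hjk
    simp_all
  constructor
  · intro hG y hxy hyn hy
    obtain ⟨k, hk, -⟩ := growth y hxy hyn hy
    exact Set.eq_empty_iff_forall_notMem.mp hG k hk
  · rintro g ⟨⟨hjg, hgn, hxg, hmg⟩, hmin⟩
    set z := 2 ^ (g + 1) * (x / 2 ^ (g + 1)) + 2 ^ g + p % 2 ^ g
    have hz (i : ℕ) : z.testBit i =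
        if i < g then p.testBit i else if i = g then true else x.testBit i :=
      Nat.testBit_splice x p g i
    refine ⟨⟨?_, ?_, ?_⟩, ?_⟩
    · refine Nat.lt_of_testBit g hxg (by simp [hz]) fun i hi => ?_
      rw [hz, if_neg (by omega), if_neg (by omega)]
    · refine Nat.lt_pow_two_of_testBit z fun i hi => ?_
      rw [hz, if_neg (by omega), if_neg (by omega)]
      exact Nat.testBit_lt_two_pow (hx.trans_le (Nat.pow_le_pow_right two_pos hi))
    · refine Nat.eq_of_testBit_eq fun i => ?_
      rw [Nat.testBit_and, hz]
      rcases lt_trichotomy i g with h | rfl | h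
      · rw [if_pos h, hpm]
      · simpa [hmg] using hpm i
      · rw [if_neg (by omega), if_neg (by omega), hagree i (by omega)]
    · rintro y ⟨hxy, hyn, hy⟩
      by_contra! hyz
      obtain ⟨k, hkG, hyk, hk⟩ := growth y hxy hyn hy
      have hgk : g ≤ k := hmin hkG
      obtain ⟨l, hyl, hzl, hl⟩ := Nat.exists_testBit_of_lt hyz
      have hpl : p.testBit l = false := by rw [← hy, Nat.testBit_and, hyl, Bool.false_and]
      have hzk := hz k
      have hzl' := hz l
      have hkl := hk l
      have hlk := hl k
      grind
end

section
/- Let n ≥ 1, let m < 2^n be a mask with popcount d, and let a ≤ b be patterns for m. Let r be the cardinality of {q : q &&& m = q ∧ a ≤ q ≤ b}. Then the cardinality of the range-PSP locus {x : x < 2^n ∧ a ≤ x &&& m ∧ x &&& m ≤ b} equals r · 2^{n−d}. -/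
/-- Among the `n`-bit numbers, the fibre of `x ↦ x &&& m` over a pattern `q` is in bijection with
the sets of positions below `n` lying outside the mask `m`. -/
lemma card_filter_land_eq (n m q : ℕ) (hm : m < 2 ^ n) (hq : q &&& m = q) :
    ((Finset.range (2 ^ n)).filter (fun x => x &&& m = q)).card =
      2 ^ ((Finset.range n).filter (fun i => ¬ m.testBit i)).card := by
  have hqm : ∀ i, (q.testBit i && m.testBit i) = q.testBit i := fun i => by
    rw [← Nat.testBit_and, hq]
  rw [← Finset.card_powerset]
  refine Finset.card_bij
    (fun x _ => (Finset.range n).filter (fun i => ¬ m.testBit i ∧ x.testBit i)) ?_ ?_ ?_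
  · intro x _
    rw [Finset.mem_powerset]
    intro i hi
    simp only [Finset.mem_filter] at hi ⊢
    exact ⟨hi.1, hi.2.1⟩
  · intro x hx y hy hxy
    simp only [Finset.mem_filter, Finset.mem_range] at hx hy
    apply Nat.eq_of_testBit_eq
    intro i
    by_cases hi : i < n
    · have h1 : (x &&& m).testBit i = (y &&& m).testBit i := by rw [hx.2, hy.2]
      have h2 := Finset.ext_iff.mp hxy i
      simp only [Nat.testBit_and, Finset.mem_filter, Finset.mem_range, hi, true_and] at h1 h2
      cases hmi : m.testBit i <;> simp_all
    · have hpow : 2 ^ n ≤ 2 ^ i := Nat.pow_le_pow_right (by norm_num) (not_lt.mp hi)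
      rw [Nat.testBit_lt_two_pow (hx.1.trans_le hpow), Nat.testBit_lt_two_pow (hy.1.trans_le hpow)]
  · intro s hs
    rw [Finset.mem_powerset] at hs
    let f : Fin n → Bool := fun i => if m.testBit i then q.testBit i else decide ((i : ℕ) ∈ s)
    have hf : ∀ i, i < n → (Nat.ofBits f).testBit i =
        if m.testBit i then q.testBit i else decide (i ∈ s) := fun i hi => by
      rw [Nat.testBit_ofBits_lt f i hi]
    refine ⟨Nat.ofBits f, ?_, ?_⟩
    · simp only [Finset.mem_filter, Finset.mem_range]
      refine ⟨Nat.ofBits_lt_two_pow f, Nat.eq_of_testBit_eq fun i => ?_⟩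
      rw [Nat.testBit_and, ← hqm i]
      by_cases hi : i < n
      · rw [hf i hi]
        cases hmi : m.testBit i <;> simp
      · rw [Nat.testBit_lt_two_pow
          (hm.trans_le (Nat.pow_le_pow_right (by norm_num) (not_lt.mp hi)))]
        simp
    · ext i
      simp only [Finset.mem_filter, Finset.mem_range]
      constructor
      · rintro ⟨hi, hmi, hx⟩
        rw [hf i hi] at hx
        simpa [hmi] using hx
      · intro hi
        obtain ⟨hin, hmi⟩ := Finset.mem_filter.mp (hs hi)
        rw [Finset.mem_range] at hin
        refine ⟨hin, hmi, ?_⟩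
        rw [hf i hin]
        simp [hmi, hi]

/-- The range-PSP locus `{x : x < 2^n ∧ a ≤ x &&& m ≤ b}` has cardinality `r·2^{n-d}`,
where `r` is the number of patterns for `m` lying in `[a, b]`. -/
theorem range_psp_locus_card (n m d a b r : ℕ) (hn : 1 ≤ n) (hm : m < 2 ^ n)
    (hd : d = ((Finset.range n).filter (fun i => m.testBit i)).card)
    (ha : a &&& m = a) (hb : b &&& m = b) (hab : a ≤ b)
    (hr : r = Set.ncard {q : ℕ | q &&& m = q ∧ a ≤ q ∧ q ≤ b}) :
    Set.ncard {x : ℕ | x < 2 ^ n ∧ a ≤ x &&& m ∧ x &&& m ≤ b} = r * 2 ^ (n - d) := by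
  have hfree : ((Finset.range n).filter (fun i => ¬ m.testBit i)).card = n - d := by
    have h := Finset.card_filter_add_card_filter_not (s := Finset.range n)
      (fun i => m.testBit i = true)
    rw [Finset.card_range] at h
    omega
  let Q := (Finset.Icc a b).filter (fun q => q &&& m = q)
  let L := (Finset.range (2 ^ n)).filter (fun x => a ≤ x &&& m ∧ x &&& m ≤ b)
  have hQ : {q : ℕ | q &&& m = q ∧ a ≤ q ∧ q ≤ b} = (Q : Set ℕ) := by
    ext q
    simp [Q, and_comm]
  have hL : {x : ℕ | x < 2 ^ n ∧ a ≤ x &&& m ∧ x &&& m ≤ b} = (L : Set ℕ) := by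
    ext x
    simp [L]
  rw [hL, hr, hQ, Set.ncard_coe_finset, Set.ncard_coe_finset]
  have hmaps : ∀ x ∈ L, x &&& m ∈ Q := by
    intro x hx
    simp only [L, Q, Finset.mem_filter, Finset.mem_Icc] at hx ⊢
    exact ⟨hx.2, by rw [Nat.and_assoc, Nat.and_self]⟩
  rw [Finset.card_eq_sum_card_fiberwise hmaps]
  refine Finset.sum_const_nat fun q hq => ?_
  simp only [Q, Finset.mem_filter, Finset.mem_Icc] at hq
  rw [← hfree, ← card_filter_land_eq n m q hm hq.2]
  congr 1
  ext x
  simp only [L, Finset.mem_filter]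
  constructor
  · rintro ⟨⟨hx, _⟩, h⟩
    exact ⟨hx, h⟩
  · rintro ⟨hx, h⟩
    exact ⟨⟨hx, h ▸ hq.1⟩, h⟩
end

section
/- Let n ≥ 1 and let m < 2^n be a contiguous mask with tail t = tail(m) and head h = head(m) (so m = 2^h − 2^t), and let a ≤ b be patterns for m. Then for every natural number x: (a ≤ x &&& m ∧ x &&& m ≤ b) if and only if (a ≤ x mod 2^h ∧ x mod 2^h < b + 2^t). (Hence within each aligned block of 2^h consecutive integers the range-PSP locus is a single interval of length b − a + 2^t.) -/
/-- Masking with the contiguous mask `2^h - 2^t` clears all bits outside positions `t, …, h-1`. -/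
theorem Nat.and_two_pow_sub_two_pow (x : ℕ) {t h : ℕ} (hth : t ≤ h) :
    x &&& (2 ^ h - 2 ^ t) = 2 ^ t * (x % 2 ^ h / 2 ^ t) := by
  have hm : 2 ^ h - 2 ^ t = 2 ^ t * (2 ^ (h - t) - 1) := by
    rw [Nat.mul_sub, ← pow_add, Nat.add_sub_cancel' hth, mul_one]
  rw [hm]
  refine Nat.eq_of_testBit_eq fun i => ?_
  simp only [Nat.testBit_and, Nat.testBit_two_pow_mul, Nat.testBit_two_pow_sub_one,
    Nat.testBit_div_two_pow, Nat.testBit_mod_two_pow]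
  by_cases hi : t ≤ i
  · have h₁ : i - t < h - t ↔ i < h := by omega
    simp [hi, h₁, Bool.and_comm]
  · simp [hi]

/-- For a contiguous mask `m = 2^h - 2^t` (tail `t`, head `h`) and patterns `a ≤ b`,
a key `x` satisfies the range restriction `a ≤ x &&& m ≤ b` iff `x mod 2^h` lies in the
interval `[a, b + 2^t)`. -/
theorem range_psp_contiguous_mask (n m t h a b : ℕ) (hn : 1 ≤ n) (hth : t < h)
    (hmask : m = 2 ^ h - 2 ^ t) (hm : m < 2 ^ n)
    (ha : a &&& m = a) (hb : b &&& m = b) (hab : a ≤ b) :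
    ∀ x : ℕ, (a ≤ x &&& m ∧ x &&& m ≤ b) ↔
      (a ≤ x % 2 ^ h ∧ x % 2 ^ h < b + 2 ^ t) := by
  intro x
  subst hmask
  rw [Nat.and_two_pow_sub_two_pow _ hth.le] at ha hb ⊢
  have ht : 0 < 2 ^ t := by positivity
  generalize a % 2 ^ h / 2 ^ t = a' at ha
  generalize b % 2 ^ h / 2 ^ t = b' at hb
  subst ha hb
  rw [Nat.mul_le_mul_left_iff ht, Nat.mul_le_mul_left_iff ht, Nat.le_div_iff_mul_le ht,
    ← Nat.lt_succ_iff (n := b'), Nat.div_lt_iff_lt_mul ht, Nat.succ_mul, mul_comm a', mul_comm b']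
end
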